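/- For every nonnegative integer n, G_3(n) = (G(n) - (-1)^n · H(n))/2, where G_3(n) counts the partitions counted by G(n) having an odd number of blue parts. -/

import Mathlib

noncomputable section

/-- Overpartitions of `n`: the first component is the set of overlined parts
(at most one overlined part of each size), the second is the multiset of
non-overlined parts; all parts are positive and the total sum is `n`. -/
def overpartitions (n : ℕ) : Set (Finset ℕ × Multiset ℕ) :=
  {p | (∀ x ∈ p.1, 0 < x) ∧ (∀ x ∈ p.2, 0 < x) ∧ p.1.sum id + p.2.sum = n}

/-- `p̄(n)`, the number of overpartitions of `n`. -/
def pbar (n : ℕ) : ℕ := (overpartitions n).ncard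

/-- Overpartitions of `n` into odd parts. -/
def overpartitionsOdd (n : ℕ) : Set (Finset ℕ × Multiset ℕ) :=
  {p | p ∈ overpartitions n ∧ (∀ x ∈ p.1, Odd x) ∧ ∀ x ∈ p.2, Odd x}

/-- `p̄_o(n)`, the number of overpartitions of `n` into odd parts. -/
def pbarOdd (n : ℕ) : ℕ := (overpartitionsOdd n).ncard

/-- Two-color partitions of `n` (first component: blue parts, second: green
parts) in which even parts may occur only in the blue color, i.e. all green
parts are odd. -/
def FSet (n : ℕ) : Set (Multiset ℕ × Multiset ℕ) :=
  {p | (∀ x ∈ p.1, 0 < x) ∧ (∀ x ∈ p.2, 0 < x) ∧ p.1.sum + p.2.sum = n ∧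
    ∀ x ∈ p.2, Odd x}

/-- `F(n)`. -/
def Fcount (n : ℕ) : ℕ := (FSet n).ncard

/-- The number of even parts of a multiset of naturals. -/
def evenParts (m : Multiset ℕ) : ℕ := Multiset.card (m.filter (fun x => Even x))

/-- `F₀(n)`: partitions counted by `F(n)` with an even number of even parts. -/
def F0 (n : ℕ) : ℕ := {p ∈ FSet n | Even (evenParts (p.1 + p.2))}.ncard

/-- `F₁(n)`: partitions counted by `F(n)` with an odd number of even parts. -/
def F1 (n : ℕ) : ℕ := {p ∈ FSet n | Odd (evenParts (p.1 + p.2))}.ncard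

/-- `F₂(n)`: partitions counted by `F(n)` with an even number of parts. -/
def F2 (n : ℕ) : ℕ := {p ∈ FSet n | Even (Multiset.card (p.1 + p.2))}.ncard

/-- `F₃(n)`: partitions counted by `F(n)` with an odd number of parts. -/
def F3 (n : ℕ) : ℕ := {p ∈ FSet n | Odd (Multiset.card (p.1 + p.2))}.ncard

/-- Partitions counted by `F(n)` whose blue parts are distinct odd numbers. -/
def QSet (n : ℕ) : Set (Multiset ℕ × Multiset ℕ) :=
  {p | p ∈ FSet n ∧ (∀ x ∈ p.1, Odd x) ∧ p.1.Nodup}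

/-- `Q(n)`. -/
def Qcount (n : ℕ) : ℕ := (QSet n).ncard

/-- Two-color partitions of `n` (first component: blue parts, second: green
parts) in which odd parts may occur only in the blue color, i.e. all green
parts are even. -/
def GSet (n : ℕ) : Set (Multiset ℕ × Multiset ℕ) :=
  {p | (∀ x ∈ p.1, 0 < x) ∧ (∀ x ∈ p.2, 0 < x) ∧ p.1.sum + p.2.sum = n ∧
    ∀ x ∈ p.2, Even x}

/-- `G(n)`. -/
def Gcount (n : ℕ) : ℕ := (GSet n).ncard

/-- `G₀(n)`: partitions counted by `G(n)` with an even number of blue even parts. -/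
def G0 (n : ℕ) : ℕ := {p ∈ GSet n | Even (evenParts p.1)}.ncard

/-- `G₁(n)`: partitions counted by `G(n)` with an odd number of blue even parts. -/
def G1 (n : ℕ) : ℕ := {p ∈ GSet n | Odd (evenParts p.1)}.ncard

/-- `G₂(n)`: partitions counted by `G(n)` with an even number of blue parts. -/
def G2 (n : ℕ) : ℕ := {p ∈ GSet n | Even (Multiset.card p.1)}.ncard

/-- `G₃(n)`: partitions counted by `G(n)` with an odd number of blue parts. -/
def G3 (n : ℕ) : ℕ := {p ∈ GSet n | Odd (Multiset.card p.1)}.ncard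

/-- `G₄(n)`: partitions counted by `G(n)` with an even total number of parts. -/
def G4 (n : ℕ) : ℕ := {p ∈ GSet n | Even (Multiset.card (p.1 + p.2))}.ncard

/-- `G₅(n)`: partitions counted by `G(n)` with an odd total number of parts. -/
def G5 (n : ℕ) : ℕ := {p ∈ GSet n | Odd (Multiset.card (p.1 + p.2))}.ncard

/-- Partitions of `n` in which the odd parts are distinct. -/
def HSet (n : ℕ) : Set (Multiset ℕ) :=
  {m | (∀ x ∈ m, 0 < x) ∧ m.sum = n ∧ (m.filter (fun x => Odd x)).Nodup}

/-- `H(n)`. -/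
def Hcount (n : ℕ) : ℕ := (HSet n).ncard

/-- Partitions of `n` into distinct parts whose even parts are all
congruent to `2` modulo `4`. -/
def KSet (n : ℕ) : Set (Finset ℕ) :=
  {s | (∀ x ∈ s, 0 < x) ∧ s.sum id = n ∧ ∀ x ∈ s, Even x → x % 4 = 2}

/-- `K(n)`: the signed count of partitions in `KSet n`, each weighted by
`(-1)^j` where `j` is the number of even parts. -/
def Kcount (n : ℕ) : ℤ :=
  ({s ∈ KSet n | Even (s.filter (fun x => Even x)).card}.ncard : ℤ) -
  ({s ∈ KSet n | Odd (s.filter (fun x => Even x)).card}.ncard : ℤ)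

/-- Partitions counted by `G(n)` whose blue parts are distinct odd numbers. -/
def RSet (n : ℕ) : Set (Multiset ℕ × Multiset ℕ) :=
  {p | p ∈ GSet n ∧ (∀ x ∈ p.1, Odd x) ∧ p.1.Nodup}

/-- `R(n)`. -/
def Rcount (n : ℕ) : ℕ := (RSet n).ncard

/-- Two-color partitions of `n` in which all parts of the same color are
distinct and odd parts may occur only in the blue color: the first component
is the (finite) set of blue parts (distinct positive integers), the second the
set of green parts (distinct positive even integers). -/
def LSet (n : ℕ) : Set (Finset ℕ × Finset ℕ) :=
  {p | (∀ x ∈ p.1, 0 < x) ∧ (∀ x ∈ p.2, 0 < x ∧ Even x) ∧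
    p.1.sum id + p.2.sum id = n}

/-- `L₀(n)`: partitions counted by `L(n)` with an even number of blue even parts. -/
def L0 (n : ℕ) : ℕ := {p ∈ LSet n | Even (p.1.filter (fun x => Even x)).card}.ncard

/-- `L₁(n)`: partitions counted by `L(n)` with an odd number of blue even parts. -/
def L1 (n : ℕ) : ℕ := {p ∈ LSet n | Odd (p.1.filter (fun x => Even x)).card}.ncard

/-- `L₂(n)`: partitions counted by `L(n)` with an even number of blue parts. -/
def L2 (n : ℕ) : ℕ := {p ∈ LSet n | Even p.1.card}.ncard

/-- `L₃(n)`: partitions counted by `L(n)` with an odd number of blue parts. -/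
def L3 (n : ℕ) : ℕ := {p ∈ LSet n | Odd p.1.card}.ncard

/-- `k` is the largest even number that is a part or twice a repeated part. -/
def IsKey (s : Multiset ℕ) (k : ℕ) : Prop :=
  Even k ∧ 0 < k ∧ (k ∈ s ∨ 2 ≤ s.count (k / 2)) ∧
    ∀ y, Even y → k < y → y ∉ s ∧ s.count (y / 2) < 2

/-- merge or split at `k`. -/
def toggle (k : ℕ) (s : Multiset ℕ) : Multiset ℕ :=
  if k ∈ s then k / 2 ::ₘ k / 2 ::ₘ s.erase k else k ::ₘ (s.erase (k / 2)).erase (k / 2)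

theorem IsKey.unique {s : Multiset ℕ} {k l : ℕ} (h : IsKey s k) (h' : IsKey s l) : k = l := by
  obtain ⟨a, b, c, d⟩ := h
  obtain ⟨a', b', c', d'⟩ := h'
  rcases lt_trichotomy k l with h | h | h
  · have := d l a' h
    rcases c' with c' | c'
    · exact absurd c' this.1
    · omega
  · exact h
  · have := d' k a h
    rcases c with c | c
    · exact absurd c this.1
    · omega

theorem IsKey.count_le {s : Multiset ℕ} {k : ℕ} (h : IsKey s k) : s.count k ≤ 1 := by
  obtain ⟨a, b, c, d⟩ := h
  have := (d (2 * k) (even_two_mul k) (by omega)).2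
  rw [Nat.mul_div_cancel_left _ (by norm_num)] at this
  omega

theorem IsKey.exists {s : Multiset ℕ} (hp : ∀ x ∈ s, 0 < x)
    (h : ¬ ((∀ x ∈ s, Odd x) ∧ s.Nodup)) : ∃ k, IsKey s k := by
  classical
  let P : ℕ → Prop := fun k => Even k ∧ 0 < k ∧ (k ∈ s ∨ 2 ≤ s.count (k / 2))
  have hb : ∀ k, P k → k ≤ 2 * s.sum := by
    rintro k ⟨a, b, c⟩
    rcases c with c | c
    · have := Multiset.le_sum_of_mem c
      omega
    · have hm : k / 2 ∈ s := Multiset.count_pos.1 (by omega)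
      have := Multiset.le_sum_of_mem hm
      obtain ⟨r, rfl⟩ := a
      omega
  have hex : ∃ k, P k := by
    by_contra hne
    push Not at hne
    apply h
    constructor
    · intro x hx
      by_contra ho
      exact hne x ⟨Nat.not_odd_iff_even.1 ho, hp x hx, Or.inl hx⟩
    · rw [Multiset.nodup_iff_count_le_one]
      intro x
      by_contra hc
      have hm : x ∈ s := Multiset.count_pos.1 (by omega)
      refine hne (2 * x) ⟨even_two_mul x, by have := hp x hm; omega, Or.inr ?_⟩
      rw [Nat.mul_div_cancel_left _ (by norm_num)]
      omega
  obtain ⟨k0, hk0⟩ := hex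
  have hs := Nat.findGreatest_spec (P := P) (hb k0 hk0) hk0
  refine ⟨Nat.findGreatest P (2 * s.sum), hs.1, hs.2.1, hs.2.2, ?_⟩
  intro y hy hlt
  have hn : ¬ P y := fun hP => Nat.findGreatest_is_greatest hlt (hb y hP) hP
  refine ⟨fun hm => hn ⟨hy, by omega, Or.inl hm⟩, ?_⟩
  by_contra hc
  exact hn ⟨hy, by omega, Or.inr (by omega)⟩

theorem key_half_count {s : Multiset ℕ} {k : ℕ} (h : IsKey s k) (hk : k ∉ s) :
    ∃ t, s = k / 2 ::ₘ k / 2 ::ₘ t := by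
  have hc : 2 ≤ s.count (k / 2) := h.2.2.1.resolve_left hk
  have h1 : k / 2 ∈ s := Multiset.count_pos.1 (by omega)
  obtain ⟨u, rfl⟩ := Multiset.exists_cons_of_mem h1
  have h2 : k / 2 ∈ u := Multiset.count_pos.1 (by
    rw [Multiset.count_cons_self] at hc; omega)
  obtain ⟨t, rfl⟩ := Multiset.exists_cons_of_mem h2
  exact ⟨t, rfl⟩

/-- The two forms of a keyed multiset. -/
theorem key_cases {s : Multiset ℕ} {k : ℕ} (h : IsKey s k) :
    ∃ t, k ∉ t ∧ ((s = k ::ₘ t ∧ toggle k s = k / 2 ::ₘ k / 2 ::ₘ t) ∨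
      (s = k / 2 ::ₘ k / 2 ::ₘ t ∧ toggle k s = k ::ₘ t)) := by
  by_cases hk : k ∈ s
  · obtain ⟨t, rfl⟩ := Multiset.exists_cons_of_mem hk
    refine ⟨t, ?_, Or.inl ⟨rfl, by simp [toggle]⟩⟩
    have := h.count_le
    rw [Multiset.count_cons_self] at this
    exact Multiset.count_eq_zero.1 (by omega)
  · obtain ⟨t, rfl⟩ := key_half_count h hk
    refine ⟨t, fun hm => hk (by simp [hm]), Or.inr ⟨rfl, ?_⟩⟩
    unfold toggle
    rw [if_neg hk]
    simp

theorem IsKey.toggle_key {s : Multiset ℕ} {k : ℕ} (h : IsKey s k) : IsKey (toggle k s) k := by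
  have hh := h
  obtain ⟨t, hkt, ⟨rfl, e⟩ | ⟨rfl, e⟩⟩ := key_cases h
  · rw [e]
    obtain ⟨a, b, c, d⟩ := h
    refine ⟨a, b, Or.inr (by simp), ?_⟩
    intro y hy hlt
    have := d y hy hlt
    have hne : y / 2 ≠ k / 2 := by
      obtain ⟨r, rfl⟩ := a
      obtain ⟨q, rfl⟩ := hy
      omega
    constructor
    · intro hm
      simp only [Multiset.mem_cons] at hm this
      rcases hm with hm | hm | hm
      · omega
      · omega
      · exact this.1 (Or.inr hm)
    · rw [Multiset.count_cons_of_ne hne, Multiset.count_cons_of_ne hne]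
      exact lt_of_le_of_lt (Multiset.count_le_count_cons _ _ _) this.2
  · rw [e]
    obtain ⟨a, b, c, d⟩ := h
    refine ⟨a, b, Or.inl (by simp), ?_⟩
    intro y hy hlt
    have := d y hy hlt
    constructor
    · intro hm
      simp only [Multiset.mem_cons] at hm this
      rcases hm with hm | hm
      · omega
      · exact this.1 (Or.inr (Or.inr hm))
    · by_cases hy2 : y / 2 = k
      · rw [hy2, Multiset.count_cons_self, Multiset.count_eq_zero.2 hkt]
        norm_num
      · rw [Multiset.count_cons_of_ne hy2]
        exact lt_of_le_of_lt ((Multiset.count_le_count_cons _ _ _).trans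
          (Multiset.count_le_count_cons _ _ _)) this.2

theorem IsKey.toggle_toggle {s : Multiset ℕ} {k : ℕ} (h : IsKey s k) :
    toggle k (toggle k s) = s := by
  have hlt : k / 2 ≠ k := by have := h.2.1; omega
  obtain ⟨t, hkt, ⟨rfl, e⟩ | ⟨rfl, e⟩⟩ := key_cases h
  · rw [e]
    unfold toggle
    rw [if_neg (by simp [hkt, hlt.symm])]
    simp
  · rw [e]
    simp [toggle]

theorem IsKey.toggle_sum {s : Multiset ℕ} {k : ℕ} (h : IsKey s k) :
    (toggle k s).sum = s.sum := by
  obtain ⟨t, hkt, ⟨rfl, e⟩ | ⟨rfl, e⟩⟩ := key_cases h <;> rw [e] <;>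
  · obtain ⟨r, hr⟩ := h.1
    simp only [Multiset.sum_cons]
    omega

theorem IsKey.toggle_pos {s : Multiset ℕ} {k : ℕ} (h : IsKey s k) (hp : ∀ x ∈ s, 0 < x) :
    ∀ x ∈ toggle k s, 0 < x := by
  have h0 := h.2.1
  have h2 : 0 < k / 2 := by
    obtain ⟨r, hr⟩ := h.1
    omega
  obtain ⟨t, hkt, ⟨rfl, e⟩ | ⟨rfl, e⟩⟩ := key_cases h <;> rw [e] <;>
    simp only [Multiset.mem_cons] at hp ⊢ <;> intro x hx <;> grind

theorem IsKey.toggle_card {s : Multiset ℕ} {k : ℕ} (h : IsKey s k) :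
    (-1 : ℚ) ^ (Multiset.card s) + (-1) ^ (Multiset.card (toggle k s)) = 0 := by
  obtain ⟨t, hkt, ⟨rfl, e⟩ | ⟨rfl, e⟩⟩ := key_cases h <;> rw [e] <;>
    simp only [Multiset.card_cons, pow_succ] <;> ring

theorem IsKey.not_good {s : Multiset ℕ} {k : ℕ} (h : IsKey s k) :
    ¬ ((∀ x ∈ s, Odd x) ∧ s.Nodup) := by
  rintro ⟨a, b⟩
  rcases h.2.2.1 with c | c
  · exact Nat.not_odd_iff_even.2 h.1 (a k c)
  · have := Multiset.nodup_iff_count_le_one.1 b (k / 2)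
    omega

theorem neg_one_pow_card {s : Multiset ℕ} (h : ∀ x ∈ s, Odd x) :
    (-1 : ℚ) ^ (Multiset.card s) = (-1) ^ s.sum := by
  induction s using Multiset.induction_on with
  | empty => simp
  | cons a s ih =>
    rw [Multiset.card_cons, Multiset.sum_cons, pow_succ, pow_add,
      ih (fun x hx => h x (Multiset.mem_cons_of_mem hx)), (h a (by simp)).neg_one_pow]
    ring

theorem even_sum_of {s : Multiset ℕ} (h : ∀ x ∈ s, Even x) : Even s.sum := by
  induction s using Multiset.induction_on with
  | empty => simp
  | cons a s ih =>
    rw [Multiset.sum_cons]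
    exact (h a (by simp)).add (ih (fun x hx => h x (Multiset.mem_cons_of_mem hx)))

theorem finite_ms (n : ℕ) : {s : Multiset ℕ | (∀ x ∈ s, 0 < x) ∧ s.sum ≤ n}.Finite := by
  apply (Set.finite_Iic (n • (Multiset.range (n + 1)))).subset
  rintro s ⟨hp, hs⟩
  rw [Set.mem_Iic, Multiset.le_iff_count]
  intro a
  by_cases ha : a ∈ s
  · have h1 : a ≤ n := (Multiset.le_sum_of_mem ha).trans hs
    rw [Multiset.count_nsmul, Multiset.count_eq_one_of_mem (Multiset.nodup_range _)
      (Multiset.mem_range.2 (by omega)), mul_one]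
    have h2 : Multiset.card s • 1 ≤ s.sum := Multiset.card_nsmul_le_sum (fun x hx => hp x hx)
    have h3 := Multiset.count_le_card a s
    simp only [smul_eq_mul, mul_one] at h2
    omega
  · rw [Multiset.count_eq_zero.2 ha]
    exact Nat.zero_le _

theorem GSet_finite (n : ℕ) : (GSet n).Finite := by
  apply ((finite_ms n).prod (finite_ms n)).subset
  rintro ⟨a, b⟩ ⟨h1, h2, h3, h4⟩
  simp only at h1 h2 h3
  exact ⟨⟨h1, by simp only; omega⟩, ⟨h2, by simp only; omega⟩⟩

theorem R_eq_H (n : ℕ) : Rcount n = Hcount n := by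
  unfold Rcount Hcount
  refine Set.ncard_congr (fun p _ => p.1 + p.2) ?_ ?_ ?_
  · rintro ⟨a, b⟩ ⟨⟨h1, h2, h3, h4⟩, h5, h6⟩
    simp only at h1 h2 h3 h4 h5 h6
    refine ⟨?_, by simpa using h3, ?_⟩
    · intro x hx
      rcases Multiset.mem_add.1 hx with hx | hx
      · exact h1 x hx
      · exact h2 x hx
    · rw [Multiset.filter_add, Multiset.filter_eq_self.2 h5,
        Multiset.filter_eq_nil.2 (fun x hx => Nat.not_odd_iff_even.2 (h4 x hx))]
      simpa using h6
  · rintro ⟨a, b⟩ ⟨c, d⟩ ⟨⟨h1, h2, h3, h4⟩, h5, h6⟩ ⟨⟨h1', h2', h3', h4'⟩, h5', h6'⟩ he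
    simp only at h4 h4' h5 h5' he
    have e1 := congrArg (Multiset.filter (fun x => Odd x)) he
    rw [Multiset.filter_add, Multiset.filter_eq_self.2 h5,
        Multiset.filter_eq_nil.2 (fun x hx => Nat.not_odd_iff_even.2 (h4 x hx)),
        Multiset.filter_add, Multiset.filter_eq_self.2 h5',
        Multiset.filter_eq_nil.2 (fun x hx => Nat.not_odd_iff_even.2 (h4' x hx))] at e1
    simp only [add_zero] at e1
    subst e1
    rw [add_right_inj] at he
    rw [he]
  · rintro m ⟨h1, h2, h3⟩
    have hadd := Multiset.filter_add_not (fun x => Odd x) m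
    refine ⟨(m.filter (fun x => Odd x), m.filter (fun x => ¬ Odd x)), ⟨⟨?_, ?_, ?_, ?_⟩, ?_, h3⟩, hadd⟩
    · exact fun x hx => h1 x (Multiset.mem_of_mem_filter hx)
    · exact fun x hx => h1 x (Multiset.mem_of_mem_filter hx)
    · simp only
      rw [← Multiset.sum_add, hadd, h2]
    · exact fun x hx => Nat.not_odd_iff_even.1 (Multiset.mem_filter.1 hx).2
    · exact fun x hx => Multiset.of_mem_filter hx

/-- `G₃(n) = (G(n) - (-1)^n * H(n)) / 2`. -/
theorem G3_eq (n : ℕ) : (G3 n : ℚ) = ((Gcount n : ℚ) - (-1) ^ n * (Hcount n : ℚ)) / 2 := by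
  classical
  have hfin := GSet_finite n
  set T := hfin.toFinset with hT
  have memT : ∀ p, p ∈ T ↔ p ∈ GSet n := fun p => hfin.mem_toFinset
  have hG : Gcount n = T.card := Set.ncard_eq_toFinset_card _ hfin
  have hG3 : G3 n = (T.filter (fun p => Odd (Multiset.card p.1))).card := by
    unfold G3
    rw [← Set.ncard_coe_finset]
    congr 1
    ext p
    simp [memT]
  have hR : Rcount n = (T.filter (fun p => (∀ x ∈ p.1, Odd x) ∧ p.1.Nodup)).card := by
    unfold Rcount
    rw [← Set.ncard_coe_finset]
    congr 1
    ext p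
    simp [memT, RSet]
  have hs1 : ∑ p ∈ T, (-1 : ℚ) ^ (Multiset.card p.1) = (Gcount n : ℚ) - 2 * G3 n := by
    rw [hG, hG3, Finset.card_filter, Finset.card_eq_sum_ones]
    push_cast
    rw [Finset.mul_sum, ← Finset.sum_sub_distrib]
    refine Finset.sum_congr rfl fun p _ => ?_
    by_cases ho : Odd (Multiset.card p.1)
    · rw [if_pos ho, ho.neg_one_pow]; norm_num
    · rw [if_neg ho, (Nat.not_odd_iff_even.1 ho).neg_one_pow]; norm_num
  have hs2 : ∑ p ∈ T, (-1 : ℚ) ^ (Multiset.card p.1) = (-1) ^ n * (Rcount n : ℚ) := by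
    rw [← Finset.sum_filter_add_sum_filter_not T
      (fun p => (∀ x ∈ p.1, Odd x) ∧ p.1.Nodup)]
    have hz : ∑ p ∈ T.filter (fun p => ¬ ((∀ x ∈ p.1, Odd x) ∧ p.1.Nodup)),
        (-1 : ℚ) ^ (Multiset.card p.1) = 0 := by
      have hk : ∀ p ∈ T.filter (fun p => ¬ ((∀ x ∈ p.1, Odd x) ∧ p.1.Nodup)),
          ∃ k, IsKey p.1 k := by
        intro p hp
        rw [Finset.mem_filter, memT] at hp
        exact IsKey.exists hp.1.1 hp.2
      choose! f hf using hk
      have hmem : ∀ p ∈ T.filter (fun p => ¬ ((∀ x ∈ p.1, Odd x) ∧ p.1.Nodup)),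
          (toggle (f p) p.1, p.2) ∈
            T.filter (fun p => ¬ ((∀ x ∈ p.1, Odd x) ∧ p.1.Nodup)) := by
        intro p hp
        have hkp := hf p hp
        rw [Finset.mem_filter, memT] at hp ⊢
        obtain ⟨⟨h1, h2, h3, h4⟩, h5⟩ := hp
        refine ⟨⟨hkp.toggle_pos h1, h2, ?_, h4⟩, hkp.toggle_key.not_good⟩
        simp only
        rw [hkp.toggle_sum, h3]
      refine Finset.sum_involution (fun p _ => (toggle (f p) p.1, p.2)) ?_ ?_ hmem ?_
      · exact fun p hp => (hf p hp).toggle_card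
      · intro p hp _ he
        have h1 := (hf p hp).toggle_card
        have h2 : toggle (f p) p.1 = p.1 := congrArg Prod.fst he
        rw [h2] at h1
        have : (-1 : ℚ) ^ (Multiset.card p.1) ≠ 0 := pow_ne_zero _ (by norm_num)
        apply this
        linarith
      · intro p hp
        have hu : f (toggle (f p) p.1, p.2) = f p :=
          (hf _ (hmem p hp)).unique (hf p hp).toggle_key
        simp only
        rw [hu, (hf p hp).toggle_toggle]
    rw [hz, add_zero, hR, Finset.sum_congr rfl (g := fun _ => (-1 : ℚ) ^ n)]
    · rw [Finset.sum_const, nsmul_eq_mul, mul_comm]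
    · intro p hp
      rw [Finset.mem_filter, memT] at hp
      obtain ⟨⟨h1, h2, h3, h4⟩, h5, h6⟩ := hp
      rw [neg_one_pow_card h5, ← h3, pow_add, (even_sum_of h4).neg_one_pow, mul_one]
  rw [← R_eq_H, ← hs2, hs1]
  ring
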